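/- arXiv:2512.08669 — 2 statements merged into one kernel-verified Lean document; each statement's English description precedes it below -/
import Mathlib

section
/- For every d ≥ 1 and k with 0 ≤ k ≤ d, the number of pairs (σ, c), where σ is a permutation of {1,…,d+1} in which every cycle contained in {1,…,k} has odd length and c is a 2-coloring of the cycles of σ contained in {1,…,k}, equals (d+k+1)·d!. -/
open Nat

/-- `x` lies in a cycle of `σ` all of whose elements are among the first `k` elements. -/
def IsKCycleElt {N : ℕ} (σ : Equiv.Perm (Fin N)) (k : ℕ) (x : Fin N) : Prop :=
  ∀ y, σ.SameCycle x y → (y : ℕ) < k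

/-- The length of the cycle of `σ` containing `x` (fixed points give length `1`). -/
noncomputable def cycleLen {N : ℕ} (σ : Equiv.Perm (Fin N)) (x : Fin N) : ℕ :=
  Nat.card {y // σ.SameCycle x y}

/-- `C_{d,k}`: permutations `σ` of `{1,…,d+1}` in which every cycle contained in `{1,…,k}`
has odd length, together with a 2-coloring (encoded by `Bool`) of those cycles. The coloring
is encoded as a function on elements that is constant on cycles and normalized to `false`
outside cycles contained in `{1,…,k}`. -/
def CFull (d k : ℕ) : Type :=
  {p : Equiv.Perm (Fin (d + 1)) × (Fin (d + 1) → Bool) //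
    (∀ x, IsKCycleElt p.1 k x → Odd (cycleLen p.1 x)) ∧
    (∀ x y, p.1.SameCycle x y → p.2 x = p.2 y) ∧
    (∀ x, ¬ IsKCycleElt p.1 k x → p.2 x = false)}

namespace Stmt6Aux

open Equiv Equiv.Perm Finset

/-- `A` is a union of cycles of `σ`. -/
def Inv {N : ℕ} (σ : Perm (Fin N)) (A : Finset (Fin N)) : Prop := ∀ x, σ x ∈ A ↔ x ∈ A

instance {N : ℕ} (σ : Perm (Fin N)) (A : Finset (Fin N)) : Decidable (Inv σ A) := by
  unfold Inv; infer_instance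

/-- The restriction of `σ` to an invariant set, extended by the identity. -/
def restr {N : ℕ} (σ : Perm (Fin N)) (A : Finset (Fin N)) (h : Inv σ A) : Perm (Fin N) :=
  ofSubtype (p := fun x => x ∈ A) (σ.subtypePerm h)

lemma restr_mem {N : ℕ} {σ : Perm (Fin N)} {A : Finset (Fin N)} (h : Inv σ A) {x : Fin N}
    (hx : x ∈ A) : restr σ A h x = σ x := by
  unfold restr
  exact ofSubtype_subtypePerm_of_mem h hx

lemma restr_not_mem {N : ℕ} {σ : Perm (Fin N)} {A : Finset (Fin N)} (h : Inv σ A) {x : Fin N}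
    (hx : x ∉ A) : restr σ A h x = x := by
  unfold restr
  exact ofSubtype_subtypePerm_of_not_mem h hx

/-- Signed indicator of invariance. -/
def sg {N : ℕ} (σ : Perm (Fin N)) (A : Finset (Fin N)) : ℤ :=
  if h : Inv σ A then ((sign (restr σ A h) : ℤˣ) : ℤ) else 0

lemma Inv.sameCycle {N : ℕ} {σ : Perm (Fin N)} {A : Finset (Fin N)} (h : Inv σ A) {x y : Fin N}
    (hxy : σ.SameCycle x y) : x ∈ A ↔ y ∈ A := by
  obtain ⟨n, -, rfl⟩ := hxy.exists_pow_eq'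
  induction n with
  | zero => simp
  | succ n ih =>
    rw [_root_.pow_succ', Perm.mul_apply, h]
    exact ih (by exact ⟨n, by simp⟩)

/-- The cycle of `σ` through `x`. -/
noncomputable def cyc {N : ℕ} (σ : Perm (Fin N)) (x : Fin N) : Finset (Fin N) := by
  classical exact univ.filter (fun y => σ.SameCycle x y)

lemma mem_cyc {N : ℕ} {σ : Perm (Fin N)} {x y : Fin N} : y ∈ cyc σ x ↔ σ.SameCycle x y := by
  classical simp [cyc]

lemma inv_cyc {N : ℕ} (σ : Perm (Fin N)) (x : Fin N) : Inv σ (cyc σ x) := by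
  intro y; simp [mem_cyc]

lemma card_cyc {N : ℕ} (σ : Perm (Fin N)) (x : Fin N) : cycleLen σ x = (cyc σ x).card := by
  classical
  unfold cycleLen cyc
  rw [Nat.card_eq_fintype_card, Fintype.card_subtype]

lemma isCycleOn_cyc {N : ℕ} (σ : Perm (Fin N)) (x : Fin N) :
    σ.IsCycleOn (cyc σ x : Set (Fin N)) := by
  refine ⟨⟨fun y hy => ?_, σ.injective.injOn, fun y hy => ⟨σ⁻¹ y, ?_, by simp⟩⟩, ?_⟩
  · simpa [mem_cyc] using hy
  · simpa [mem_cyc] using hy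
  · intro y hy z hz
    simp only [mem_coe, mem_cyc] at hy hz
    exact hy.symm.trans hz

lemma pow_cyc {N : ℕ} (σ : Perm (Fin N)) (x : Fin N) : (σ ^ (cycleLen σ x)) x = x := by
  rw [card_cyc]
  exact (isCycleOn_cyc σ x).pow_card_apply (mem_cyc.2 (SameCycle.refl _ _))

lemma restr_pow {N : ℕ} {σ : Perm (Fin N)} {A : Finset (Fin N)} (h : Inv σ A) (n : ℕ) {x : Fin N}
    (hx : x ∈ A) : (restr σ A h ^ n) x = (σ ^ n) x := by
  induction n with
  | zero => simp
  | succ n ih =>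
    rw [_root_.pow_succ', _root_.pow_succ', Perm.mul_apply, Perm.mul_apply, ih, restr_mem]
    exact (h.sameCycle ⟨n, by simp⟩).1 hx

lemma sign_odd {N : ℕ} {σ : Perm (Fin N)} {A : Finset (Fin N)} (h : Inv σ A)
    (ho : ∀ x ∈ A, Odd (cycleLen σ x)) : sign (restr σ A h) = 1 := by
  set m := ∏ x ∈ A, cycleLen σ x with hm
  have hmo : Odd m := by
    rw [hm]
    exact Finset.prod_induction _ Odd (fun _ _ => Odd.mul) odd_one ho
  have h1 : restr σ A h ^ m = 1 := by
    ext1 x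
    by_cases hx : x ∈ A
    · rw [restr_pow h m hx]
      obtain ⟨r, hr⟩ : cycleLen σ x ∣ m := Finset.dvd_prod_of_mem _ hx
      rw [hr, pow_mul]
      have := pow_cyc σ x
      exact (Function.IsFixedPt.perm_pow (e := σ ^ cycleLen σ x) this r)
    · exact Function.IsFixedPt.perm_pow (e := restr σ A h) (restr_not_mem h hx) m
  have h2 : sign (restr σ A h) ^ m = 1 := by rw [← map_pow, h1, map_one]
  rcases Int.units_eq_one_or (sign (restr σ A h)) with h3 | h3
  · exact h3
  · rw [h3, hmo.neg_one_pow] at h2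
    exact absurd h2 (by decide)

lemma sign_cyc {N : ℕ} {σ : Perm (Fin N)} {x : Fin N} (he : ¬ Odd (cycleLen σ x)) :
    sign (restr σ (cyc σ x) (inv_cyc σ x)) = -1 := by
  have hne : σ x ≠ x := by
    intro hx
    apply he
    have : cyc σ x = {x} := by
      ext y
      rw [mem_cyc, mem_singleton]
      constructor
      · rintro ⟨i, rfl⟩
        exact Function.IsFixedPt.perm_zpow (e := σ) hx i
      · rintro rfl; exact SameCycle.refl _ _
    rw [card_cyc, this]; simp
  have h1 : restr σ (cyc σ x) (inv_cyc σ x) = cycleOf σ x := by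
    ext1 y
    by_cases hy : σ.SameCycle x y
    · rw [restr_mem _ (mem_cyc.2 hy), hy.cycleOf_apply]
    · rw [restr_not_mem _ (fun h => hy (mem_cyc.1 h)), cycleOf_apply_of_not_sameCycle hy]
  have h2 : (cycleOf σ x).support = cyc σ x := by
    ext y
    rw [mem_support_cycleOf_iff' hne, mem_cyc]
  rw [h1, (isCycle_cycleOf σ hne).sign, h2, ← card_cyc, (Nat.not_odd_iff_even.1 he).neg_one_pow]

lemma sg_union {N : ℕ} {σ : Perm (Fin N)} {A B : Finset (Fin N)} (hA : Inv σ A) (hB : Inv σ B)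
    (hAB : Disjoint A B) : sg σ (A ∪ B) = sg σ A * sg σ B := by
  have hU : Inv σ (A ∪ B) := fun x => by simp [hA x, hB x]
  have : restr σ (A ∪ B) hU = restr σ A hA * restr σ B hB := by
    ext1 x
    rw [Perm.mul_apply]
    by_cases hx : x ∈ B
    · have hx' : σ x ∉ A := fun h => Finset.disjoint_left.1 hAB h ((hB x).2 hx)
      rw [restr_mem hU (by simp [hx]), restr_mem hB hx, restr_not_mem hA hx']
    · rw [restr_not_mem hB hx]
      by_cases hxA : x ∈ A
      · rw [restr_mem hU (by simp [hxA]), restr_mem hA hxA]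
      · rw [restr_not_mem hU (by simp [hx, hxA]), restr_not_mem hA hxA]
  simp only [sg, hU, hA, hB, dif_pos, this, map_mul, Units.val_mul]

/-- For fixed `σ`, the signed count of invariant sets. -/
lemma sum_sg {N : ℕ} (σ : Perm (Fin N)) (k : ℕ) [Decidable (∀ x, IsKCycleElt σ k x → Odd (cycleLen σ x))] :
    ∑ A ∈ (univ.filter (fun x : Fin N => (x : ℕ) < k)).powerset, sg σ A =
    ∑ A ∈ (univ.filter (fun x : Fin N => (x : ℕ) < k)).powerset,
      if (∀ x, IsKCycleElt σ k x → Odd (cycleLen σ x)) ∧ Inv σ A then 1 else 0 := by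
  by_cases ho : ∀ x, IsKCycleElt σ k x → Odd (cycleLen σ x)
  · refine Finset.sum_congr rfl fun A hA => ?_
    rw [mem_powerset] at hA
    by_cases h : Inv σ A
    · rw [if_pos ⟨ho, h⟩, sg, dif_pos h, sign_odd h]
      · simp
      · intro x hx
        refine ho x fun y hy => ?_
        have := hA ((h.sameCycle hy).1 hx)
        simpa using this
    · simp [sg, h]
  · simp only [ho, false_and, if_false, Finset.sum_const_zero]
    push Not at ho
    obtain ⟨x, hx, hodd⟩ := ho
    have hsB : sg σ (cyc σ x) = -1 := by
      rw [sg, dif_pos (inv_cyc σ x), sign_cyc (by simpa using hodd)]; simp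
    have hBK : ∀ y ∈ cyc σ x, (y : ℕ) < k := fun y hy => hx y (mem_cyc.1 hy)
    have hxB : x ∈ cyc σ x := mem_cyc.2 (SameCycle.refl _ _)
    have hBinv := inv_cyc σ x
    have hInv' : ∀ A, Inv σ A → Inv σ (symmDiff A (cyc σ x)) := by
      intro A hA y
      simp only [mem_symmDiff, hA y, hBinv y]
    have hdd : ∀ A, symmDiff (symmDiff A (cyc σ x)) (cyc σ x) = A := fun A => by
      simp
    refine Finset.sum_involution (fun A _ => symmDiff A (cyc σ x)) ?_ ?_ ?_ ?_
    · intro A _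
      by_cases hA : Inv σ A
      · by_cases hxA : x ∈ A
        · have hsub : cyc σ x ⊆ A := fun y hy => (hA.sameCycle (mem_cyc.1 hy)).1 hxA
          have hs : symmDiff A (cyc σ x) = A \ cyc σ x := by
            ext y; simp only [mem_symmDiff, mem_sdiff]
            have := @hsub y
            tauto
          have := sg_union (hs ▸ hInv' A hA) hBinv Finset.sdiff_disjoint
          rw [Finset.sdiff_union_of_subset hsub, hsB] at this
          rw [hs, this]; ring
        · have hdis : Disjoint A (cyc σ x) := by
            rw [Finset.disjoint_right]
            intro y hy hyA
            exact hxA ((hA.sameCycle (mem_cyc.1 hy)).2 hyA)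
          have hs : symmDiff A (cyc σ x) = A ∪ cyc σ x := by
            rw [hdis.symmDiff_eq_sup]; rfl
          rw [hs, sg_union hA hBinv hdis, hsB]; ring
      · have hA' : ¬ Inv σ (symmDiff A (cyc σ x)) := fun h => hA (hdd A ▸ hInv' _ h)
        simp [sg, hA, hA']
    · intro A _ _ heq
      have : x ∈ symmDiff A (cyc σ x) ↔ x ∈ A := by rw [heq]
      simp only [mem_symmDiff, hxB] at this
      tauto
    · intro A hA
      rw [mem_powerset] at hA ⊢
      intro y hy
      rw [mem_symmDiff] at hy
      rcases hy with hy | hy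
      · exact hA hy.1
      · simpa using hBK y hy.1
    · intro A _
      exact hdd A

/-- For fixed `A`, the signed count of permutations leaving `A` invariant. -/
lemma sum_perm {N : ℕ} (A : Finset (Fin N)) :
    ∑ σ : Perm (Fin N), sg σ A = if A.card ≤ 1 then (((N - A.card)! : ℕ) : ℤ) else 0 := by
  split_ifs with hc
  · have hone : ∀ σ, sg σ A = if Inv σ A then 1 else 0 := by
      intro σ
      by_cases h : Inv σ A
      · rw [if_pos h, sg, dif_pos h]
        have : restr σ A h = 1 := by
          ext1 x
          by_cases hx : x ∈ A
          · rw [restr_mem h hx]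
            exact Finset.card_le_one.1 hc _ ((h x).2 hx) _ hx
          · exact restr_not_mem h hx
        rw [this]; simp
      · simp [sg, h]
    simp only [hone]
    rw [Finset.sum_boole]
    congr 1
    rcases Nat.le_one_iff_eq_zero_or_eq_one.1 hc with h0 | h1
    · rw [Finset.card_eq_zero] at h0
      subst h0
      have : ∀ σ : Perm (Fin N), Inv σ ∅ := fun σ x => by simp
      simp [this, Fintype.card_perm]
    · obtain ⟨a, rfl⟩ := Finset.card_eq_one.1 h1
      rw [← Fintype.card_subtype]
      have e := Equiv.Perm.subtypeEquivSubtypePerm (fun x : Fin N => x ≠ a)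
      have e2 : {f : Perm (Fin N) // ∀ x, ¬ (x ≠ a) → f x = x} ≃ {σ : Perm (Fin N) // Inv σ {a}} := by
        refine Equiv.subtypeEquivRight fun σ => ?_
        simp only [Inv, mem_singleton]
        constructor
        · intro h x
          have ha := h a (by simp)
          rw [← σ.injective.eq_iff (a := x) (b := a), ha]
        · intro h x hx
          simp only [ne_eq, not_not] at hx
          subst hx
          exact (h x).2 rfl
      rw [← Fintype.card_congr (e.trans e2), Fintype.card_perm]
      simp [Fintype.card_subtype_compl]
  · push Not at hc
    obtain ⟨a, ha, b, hb, hab⟩ := Finset.one_lt_card.1 hc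
    have hsw : ∀ x, swap a b x ∈ A ↔ x ∈ A := by
      intro x
      rw [swap_apply_def]
      split_ifs with h1 h2
      · simp [h1, ha, hb]
      · simp [h2, ha, hb]
      · rfl
    have hInv' : ∀ σ, Inv σ A → Inv (σ * swap a b) A := by
      intro σ h x
      rw [Perm.mul_apply, h, hsw]
    refine Finset.sum_involution (fun σ _ => σ * swap a b) ?_ ?_ ?_ ?_
    · intro σ _
      by_cases h : Inv σ A
      · have : restr (σ * swap a b) A (hInv' σ h) = restr σ A h * swap a b := by
          ext1 x
          rw [Perm.mul_apply]
          by_cases hx : x ∈ A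
          · rw [restr_mem _ hx, restr_mem _ ((hsw x).2 hx), Perm.mul_apply]
          · rw [restr_not_mem _ hx, restr_not_mem _ (fun h => hx ((hsw x).1 h)),
              swap_apply_of_ne_of_ne]
            · rintro rfl; exact hx ha
            · rintro rfl; exact hx hb
        rw [sg, sg, dif_pos h, dif_pos (hInv' σ h), this, map_mul, sign_swap hab]
        simp
      · have h' : ¬ Inv (σ * swap a b) A := fun h2 => h (by
          have := hInv' _ h2
          rwa [mul_assoc, swap_mul_self, mul_one] at this)
        simp [sg, h, h']
    · intro σ _ _ heq
      have : swap a b = 1 := by simpa using heq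
      exact hab (swap_eq_one_iff.1 this)
    · intro σ _; exact mem_univ _
    · intro σ _
      simp [mul_assoc]

open Classical in
/-- Colorings are the same as invariant sets contained in the first `k` elements. -/
noncomputable def colorEquiv (d k : ℕ) : CFull d k ≃
    {p : Perm (Fin (d + 1)) × Finset (Fin (d + 1)) //
      (∀ x ∈ p.2, (x : ℕ) < k) ∧
      ((∀ x, IsKCycleElt p.1 k x → Odd (cycleLen p.1 x)) ∧ Inv p.1 p.2)} where
  toFun p := ⟨(p.1.1, univ.filter fun x => p.1.2 x = true), by
    obtain ⟨⟨σ, c⟩, h1, h2, h3⟩ := p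
    refine ⟨fun x hx => ?_, h1, fun x => ?_⟩
    · simp only [mem_filter, mem_univ, true_and] at hx
      by_contra hlt
      have := h3 x (fun h => hlt (h x (SameCycle.refl _ _)))
      simp only at this
      simp [this] at hx
    · have := h2 x (σ x) (by simp [SameCycle.refl])
      simp only at this
      simp [this]⟩
  invFun p := ⟨(p.1.1, fun x => decide (x ∈ p.1.2)), by
    obtain ⟨⟨σ, A⟩, h1, h2, h3⟩ := p
    refine ⟨h2, fun x y hxy => ?_, fun x hx => ?_⟩
    · simp only [decide_eq_decide]
      exact Inv.sameCycle h3 hxy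
    · simp only [decide_eq_false_iff_not]
      intro hxA
      exact hx fun y hy => h1 y ((Inv.sameCycle h3 hy).1 hxA)⟩
  left_inv p := by
    apply Subtype.ext
    apply Prod.ext
    · rfl
    · funext x; simp
  right_inv p := by
    apply Subtype.ext
    apply Prod.ext
    · rfl
    · ext x; simp

end Stmt6Aux

/-- For every `d ≥ 1` and `0 ≤ k ≤ d`, the number of pairs `(σ, c)` where `σ` is
a permutation of `{1,…,d+1}` in which every cycle contained in `{1,…,k}` is odd and `c` is a
2-coloring of those cycles, equals `(d+k+1)·d!`. -/
theorem stmt6 (d k : ℕ) (hd : 1 ≤ d) (hk : k ≤ d) :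
    Nat.card (CFull d k) = (d + k + 1) * d ! := by
  classical
  have hK : (Finset.univ.filter (fun x : Fin (d + 1) => (x : ℕ) < k)).card = k := by
    rw [Fin.card_filter_val_lt]
    omega
  have key : ((Nat.card (CFull d k) : ℕ) : ℤ) =
      ∑ σ : Equiv.Perm (Fin (d + 1)),
        ∑ A ∈ (Finset.univ.filter (fun x : Fin (d + 1) => (x : ℕ) < k)).powerset,
          Stmt6Aux.sg σ A := by
    rw [Nat.card_congr (Stmt6Aux.colorEquiv d k), Nat.card_eq_fintype_card, Fintype.card_subtype,
      Finset.sum_congr rfl fun σ _ => Stmt6Aux.sum_sg σ k, ← Finset.sum_product',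
      Finset.sum_boole]
    congr 2
    ext p
    simp [Finset.subset_iff]
  have h2 := Finset.sum_powerset_apply_card
    (fun j => if j ≤ 1 then (((d + 1 - j)! : ℕ) : ℤ) else 0)
    (x := Finset.univ.filter (fun x : Fin (d + 1) => (x : ℕ) < k))
  rw [Finset.sum_comm, Finset.sum_congr rfl fun A _ => Stmt6Aux.sum_perm A, h2, hK] at key
  have h3 : ∑ m ∈ Finset.range (k + 1),
      k.choose m • (if m ≤ 1 then (((d + 1 - m)! : ℕ) : ℤ) else 0) =
      (((d + 1)! : ℕ) : ℤ) + k * ((d ! : ℕ) : ℤ) := by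
    rcases k with _ | k
    · simp
    · rw [Finset.sum_range_succ', Finset.sum_range_succ']
      rw [Finset.sum_eq_zero]
      · simp; ring
      · intro m _
        simp
  rw [h3] at key
  rw [Nat.factorial_succ] at key
  zify
  rw [key]
  push_cast
  ring
end

section
/- For every d ≥ 1, k with 0 ≤ k ≤ d, and n ≥ 0, d!·P_{d,k}(n) = ∑_{j=0}^{d} |C_{d,k}(j)| · n^j, where |C_{d,k}(j)| is the number of permutations of {1,…,d+1} with exactly j+1 cycles such that every cycle contained in {1,…,k} has odd length, together with a 2-coloring of those cycles. -/
open Nat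

/-- `P d k n = ∑_{i=0}^{k} C(k,i) · C(n+d-i, d)`. -/
def P (d k n : ℕ) : ℕ := ∑ i ∈ Finset.range (k + 1), k.choose i * (n + d - i).choose d

/-- The total number of cycles of a permutation (fixed points count as singleton cycles). -/
def numCycles {α : Type*} [Fintype α] [DecidableEq α] (σ : Equiv.Perm α) : ℕ :=
  Multiset.card σ.cycleType + (Fintype.card α - σ.cycleType.sum)

/-- `C_{d,k}(j)`: permutations of `{1,…,d+1}` with exactly `j+1` cycles such that every cycle
contained in `{1,…,k}` has odd length, together with a 2-coloring of those cycles. -/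
def CSet (d k j : ℕ) : Type :=
  {p : Equiv.Perm (Fin (d + 1)) × (Fin (d + 1) → Bool) //
    numCycles p.1 = j + 1 ∧
    (∀ x, IsKCycleElt p.1 k x → Odd (cycleLen p.1 x)) ∧
    (∀ x y, p.1.SameCycle x y → p.2 x = p.2 y) ∧
    (∀ x, ¬ IsKCycleElt p.1 k x → p.2 x = false)}


section Helpers
open Finset Classical Equiv

/-- Type of cycles of a permutation. -/
abbrev CQ {N : ℕ} (σ : Perm (Fin N)) : Type := Quotient (Perm.SameCycle.setoid σ)

/-- cycle of an element -/
def cls {N : ℕ} (σ : Perm (Fin N)) (x : Fin N) : CQ σ := Quotient.mk _ x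

/-- invariance -/
def PInv {N : ℕ} {β : Type*} (σ : Perm (Fin N)) (f : Fin N → β) : Prop := ∀ x, f (σ x) = f x

noncomputable instance {N : ℕ} (σ : Perm (Fin N)) : Fintype (CQ σ) := Fintype.ofFinite _

theorem cls_eq {N : ℕ} {σ : Perm (Fin N)} {x y : Fin N} : cls σ x = cls σ y ↔ σ.SameCycle x y := by
  unfold cls
  rw [Quotient.eq]; rfl

theorem cls_out {N : ℕ} {σ : Perm (Fin N)} (q : CQ σ) : cls σ q.out = q := Quotient.out_eq q

theorem inv_cls {N : ℕ} (σ : Perm (Fin N)) : PInv σ (cls σ) := by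
  intro x
  rw [cls_eq, Perm.sameCycle_apply_left]

theorem PInv.zpow {N : ℕ} {β : Type*} {σ : Perm (Fin N)} {f : Fin N → β} (h : PInv σ f)
    (i : ℤ) : ∀ x, f ((σ ^ i) x) = f x := by
  induction i using Int.induction_on with
  | zero => simp
  | succ i ih => intro x; rw [zpow_add_one, Perm.mul_apply, ih, h]
  | pred i ih =>
    intro x
    rw [zpow_sub_one, Perm.mul_apply, ih]
    have := h (σ⁻¹ x)
    simpa using this.symm

theorem PInv.same {N : ℕ} {β : Type*} {σ : Perm (Fin N)} {f : Fin N → β} (h : PInv σ f)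
    {x y : Fin N} (hxy : σ.SameCycle x y) : f x = f y := by
  obtain ⟨i, rfl⟩ := hxy
  rw [h.zpow]

theorem PInv.out {N : ℕ} {β : Type*} {σ : Perm (Fin N)} {f : Fin N → β} (h : PInv σ f)
    (x : Fin N) : f (cls σ x).out = f x :=
  h.same (cls_eq.1 (cls_out _))

theorem inv_decomp {N : ℕ} {β : Type*} (p : Fin (N+1)) (τ : Perm (Fin N)) (f : Fin (N+1) → β) :
    PInv (Perm.decomposeFin.symm (p, τ)) f ↔ f 0 = f p ∧ PInv τ (fun x => f x.succ) := by
  have key : f 0 = f p → ∀ y, f (swap 0 p y) = f y := by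
    intro h y
    rw [swap_apply_def]
    split_ifs with h1 h2
    · rw [h1, h]
    · rw [h2, h]
    · rfl
  constructor
  · intro h
    have h0 : f 0 = f p := by
      have := h 0
      rw [Perm.decomposeFin_symm_apply_zero] at this
      exact this.symm
    refine ⟨h0, fun x => ?_⟩
    have := h x.succ
    rw [Perm.decomposeFin_symm_apply_succ, key h0] at this
    exact this
  · rintro ⟨h0, h1⟩ x
    refine Fin.cases ?_ (fun x => ?_) x
    · rw [Perm.decomposeFin_symm_apply_zero, h0]
    · rw [Perm.decomposeFin_symm_apply_succ, key h0]
      exact h1 x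

/-- weight of a coloring -/
noncomputable def wt {N : ℕ} {R : Type*} [CommRing R] (g : Bool → R) (σ : Perm (Fin N))
    (c : Fin N → Bool) : R := ∏ q : CQ σ, g (c q.out)

theorem wt_succ {N : ℕ} {R : Type*} [CommRing R] (g : Bool → R) (b : Fin N) (τ : Perm (Fin N))
    (c : Fin (N+1) → Bool) (hc : PInv (Perm.decomposeFin.symm (b.succ, τ)) c) :
    wt g (Perm.decomposeFin.symm (b.succ, τ)) c = wt g τ (fun x => c x.succ) := by
  unfold wt
  symm
  set σ := Perm.decomposeFin.symm (b.succ, τ) with hσ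
  have hcl := inv_cls σ
  rw [hσ, inv_decomp, ← hσ] at hcl
  refine Fintype.prod_bijective (fun q => cls σ q.out.succ) ⟨?_, ?_⟩ _ _ ?_
  · intro q r h
    have hinv : PInv σ (Fin.cons (cls τ b) (cls τ) : Fin (N+1) → CQ τ) := by
      rw [hσ, inv_decomp]
      refine ⟨by simp, ?_⟩
      simpa using inv_cls τ
    have := hinv.same (cls_eq.1 h)
    simpa [cls_out] using this
  · intro q
    have main : ∀ x : Fin N, ∃ a, cls σ (Quotient.out (a : CQ τ)).succ = cls σ x.succ := fun x =>
      ⟨cls τ x, hcl.2.out x⟩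
    rw [← cls_out q]
    generalize q.out = y
    refine Fin.cases ?_ (fun y => ?_) y
    · rw [hcl.1]; exact main b
    · exact main y
  · intro q
    simp only
    rw [hc.out]

theorem wt_zero {N : ℕ} {R : Type*} [CommRing R] (g : Bool → R) (τ : Perm (Fin N))
    (c : Fin (N+1) → Bool) (hc : PInv (Perm.decomposeFin.symm (0, τ)) c) :
    wt g (Perm.decomposeFin.symm (0, τ)) c = g (c 0) * wt g τ (fun x => c x.succ) := by
  unfold wt
  symm
  set σ := Perm.decomposeFin.symm (0, τ) with hσ
  have hcl := inv_cls σ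
  rw [hσ, inv_decomp, ← hσ] at hcl
  refine (Fintype.prod_option (f := fun o : Option (CQ τ) =>
    o.elim (g (c 0)) (fun q => g (c q.out.succ)))).symm.trans ?_
  have hinv : PInv σ (Fin.cons none (fun x => some (cls τ x)) : Fin (N+1) → Option (CQ τ)) := by
    rw [hσ, inv_decomp]
    refine ⟨by simp, ?_⟩
    intro x
    simpa using inv_cls τ x
  refine Fintype.prod_bijective
    (fun o : Option (CQ τ) => o.elim (cls σ 0) (fun q => cls σ q.out.succ)) ⟨?_, ?_⟩ _ _ ?_
  · intro q r h
    rcases q with _ | q <;> rcases r with _ | r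
    · rfl
    · have := hinv.same (cls_eq.1 h)
      simp at this
    · have := hinv.same (cls_eq.1 h)
      simp at this
    · have := hinv.same (cls_eq.1 h)
      simpa [cls_out] using this
  · intro q
    rw [← cls_out q]
    generalize q.out = y
    refine Fin.cases ?_ (fun y => ?_) y
    · exact ⟨none, rfl⟩
    · exact ⟨some (cls τ y), hcl.2.out y⟩
  · intro q
    rcases q with _ | q
    · simp [hc.out]
    · simp [hc.out]

/-- total weight for coloring -/
noncomputable def G {N : ℕ} {R : Type*} [CommRing R] (g : Bool → R) (c : Fin N → Bool) : R :=
  ∑ σ : Perm (Fin N), if PInv σ c then wt g σ c else 0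

theorem G_succ {N : ℕ} {R : Type*} [CommRing R] (g : Bool → R) (c : Fin (N+1) → Bool) :
    G g c = (g (c 0) + (#{x : Fin N | c x.succ = c 0} : ℕ)) * G g (fun x => c x.succ) := by
  have h1 : G g c = ∑ p : Fin (N+1) × Perm (Fin N),
      if PInv (Perm.decomposeFin.symm p) c then wt g (Perm.decomposeFin.symm p) c else 0 :=
    (Fintype.sum_equiv Perm.decomposeFin.symm _ _ (fun _ => rfl)).symm
  rw [h1, Fintype.sum_prod_type, Fin.sum_univ_succ, add_mul]
  congr 1
  · unfold G
    rw [Finset.mul_sum]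
    refine Finset.sum_congr rfl fun τ _ => ?_
    by_cases h : PInv (Perm.decomposeFin.symm (0, τ)) c
    · rw [if_pos h, wt_zero g τ c h, if_pos ((inv_decomp _ _ _).1 h).2]
    · rw [if_neg h, if_neg, mul_zero]
      intro h'
      exact h ((inv_decomp _ _ _).2 ⟨rfl, h'⟩)
  · rw [Finset.card_filter, Nat.cast_sum, Finset.sum_mul]
    refine Finset.sum_congr rfl fun b _ => ?_
    unfold G
    by_cases hb : c b.succ = c 0
    · rw [if_pos hb, Nat.cast_one, one_mul]
      refine Finset.sum_congr rfl fun τ _ => ?_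
      by_cases h : PInv (Perm.decomposeFin.symm (b.succ, τ)) c
      · rw [if_pos h, wt_succ g b τ c h, if_pos ((inv_decomp _ _ _).1 h).2]
      · rw [if_neg h, if_neg]
        intro h'
        exact h ((inv_decomp _ _ _).2 ⟨hb.symm, h'⟩)
    · rw [if_neg hb, Nat.cast_zero, zero_mul]
      refine Finset.sum_eq_zero fun τ _ => ?_
      rw [if_neg]
      intro h
      exact hb ((inv_decomp _ _ _).1 h).1.symm

theorem G_eq {N : ℕ} {R : Type*} [CommRing R] (g : Bool → R) (c : Fin N → Bool) :
    G g c = (∏ l ∈ range #{x | c x = true}, (g true + l)) *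
      ∏ l ∈ range #{x | c x = false}, (g false + l) := by
  induction N with
  | zero => simp [G, wt, PInv]
  | succ N ih =>
    rw [G_succ, ih, Fin.card_filter_univ_succ, Fin.card_filter_univ_succ]
    cases h : c 0 <;> simp [Finset.prod_range_succ] <;> ring

theorem numCycles_eq {N : ℕ} (σ : Perm (Fin N)) : numCycles σ = Fintype.card (CQ σ) := by
  unfold numCycles
  rw [Perm.sum_cycleType]
  have h1 : Multiset.card σ.cycleType = #σ.cycleFactorsFinset := by
    rw [Perm.cycleType_def]; simp
  have h2 : Fintype.card (Fin N) - #σ.support = #(σ.supportᶜ) := by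
    rw [Finset.card_compl]
  rw [h1, h2, ← Finset.card_disjSum, ← Finset.card_univ]
  symm
  have hs : ∀ x y, σ.SameCycle x y → (x ∈ σ.support ↔ y ∈ σ.support) := by
    intro x y h
    rw [Perm.mem_support, Perm.mem_support, not_iff_not]
    exact h.apply_eq_self_iff
  refine Finset.card_bij (fun q _ => if q.out ∈ σ.support then Sum.inl (σ.cycleOf q.out)
    else Sum.inr q.out) ?_ ?_ ?_
  · intro q _
    split_ifs with h
    · rw [Finset.inl_mem_disjSum, Perm.cycleOf_mem_cycleFactorsFinset_iff]; exact h
    · rw [Finset.inr_mem_disjSum, Finset.mem_compl]; exact h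
  · intro q _ r _ h
    rw [← cls_out q, ← cls_out r, cls_eq]
    split_ifs at h with h1 h2 h2
    · have h := Sum.inl.inj h
      have hm : r.out ∈ (σ.cycleOf q.out).support := by
        rw [h, Perm.mem_support_cycleOf_iff]
        exact ⟨Perm.SameCycle.refl _ _, h2⟩
      exact (Perm.mem_support_cycleOf_iff.1 hm).1
    · rw [Sum.inr.inj h]
  · intro z hz
    rcases z with z | z
    · rw [Finset.inl_mem_disjSum] at hz
      obtain ⟨x, hx⟩ := (Perm.mem_cycleFactorsFinset_iff.1 hz).1.nonempty_support
      have hz' := (Perm.mem_cycleFactorsFinset_support_le hz) hx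
      have hzx := Perm.cycle_is_cycleOf hx hz
      have hsc : σ.SameCycle (cls σ x).out x := cls_eq.1 (cls_out _)
      refine ⟨cls σ x, mem_univ _, ?_⟩
      rw [if_pos ((hs _ _ hsc).2 hz'), hzx, hsc.cycleOf_eq]
    · rw [Finset.inr_mem_disjSum, Finset.mem_compl] at hz
      have hsc : σ.SameCycle (cls σ z).out z := cls_eq.1 (cls_out _)
      refine ⟨cls σ z, mem_univ _, ?_⟩
      have hn := mt (hs _ _ hsc).1 hz
      rw [if_neg hn]
      congr 1
      rw [Perm.notMem_support] at hn
      exact hsc.eq_of_left hn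

/-- admissible colorings -/
def Col {N : ℕ} (σ : Perm (Fin N)) (k : ℕ) (c : Fin N → Bool) : Prop :=
  PInv σ c ∧ ∀ x, c x = true → (x : ℕ) < k

/-- number of colored structures over a permutation -/
noncomputable def AA {N : ℕ} (σ : Perm (Fin N)) (k : ℕ) : ℕ :=
  if (∀ x, IsKCycleElt σ k x → Odd (cycleLen σ x)) then #{c | Col σ k c} else 0

theorem col_iff {N : ℕ} (σ : Perm (Fin N)) (k : ℕ) (c : Fin N → Bool) :
    Col σ k c ↔ (∀ x y, σ.SameCycle x y → c x = c y) ∧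
      (∀ x, ¬ IsKCycleElt σ k x → c x = false) := by
  constructor
  · rintro ⟨h1, h2⟩
    refine ⟨fun x y h => h1.same h, fun x hx => ?_⟩
    by_contra h
    apply hx
    intro y hy
    apply h2
    rw [← h1.same hy]
    simpa using h
  · rintro ⟨h1, h2⟩
    refine ⟨fun x => (h1 _ _ (by rw [Perm.sameCycle_apply_right])).symm, fun x hx => ?_⟩
    by_contra h
    have := h2 x (fun hK => h (hK x (Perm.SameCycle.refl _ _)))
    simp [this] at hx

theorem card_CSet (d k j : ℕ) : Nat.card (CSet d k j) =
    ∑ σ : Perm (Fin (d+1)), if numCycles σ = j + 1 then AA σ k else 0 := by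
  unfold CSet
  rw [Nat.card_eq_fintype_card, Fintype.card_subtype, Finset.card_filter,
    Fintype.sum_prod_type]
  refine Finset.sum_congr rfl fun σ _ => ?_
  simp only [← col_iff]
  unfold AA
  by_cases h1 : numCycles σ = j + 1
  · by_cases h2 : (∀ x, IsKCycleElt σ k x → Odd (cycleLen σ x))
    · rw [if_pos h1, if_pos h2, Finset.card_filter]
      refine Finset.sum_congr rfl fun c _ => ?_
      simp only [h1, true_and]
      by_cases h3 : Col σ k c
      · rw [if_pos h3, if_pos ⟨h2, h3⟩]
      · rw [if_neg h3, if_neg (fun h => h3 h.2)]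
    · rw [if_pos h1, if_neg h2]
      refine Finset.sum_eq_zero fun c _ => ?_
      rw [if_neg (fun h => h2 h.2.1)]
  · rw [if_neg h1]
    refine Finset.sum_eq_zero fun c _ => ?_
    rw [if_neg (fun h => h1 h.1)]

theorem cycleLen_eq {N : ℕ} (σ : Perm (Fin N)) (x : Fin N) :
    cycleLen σ x = #{y | cls σ y = cls σ x} := by
  unfold cycleLen
  rw [Nat.card_eq_fintype_card, Fintype.card_subtype]
  congr 1
  ext y
  simp only [Finset.mem_filter, mem_univ, true_and]
  rw [eq_comm, cls_eq]

/-- sign -/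
noncomputable def eps {N : ℕ} (σ : Perm (Fin N)) (c : Fin N → Bool) : ℤ :=
  ∏ q : CQ σ, if c q.out = true then -(-1) ^ (cycleLen σ q.out) else 1

theorem eps_eq {N : ℕ} (σ : Perm (Fin N)) (c : Fin N → Bool) (h : PInv σ c) :
    (-1) ^ (#{x | c x = true}) * wt (fun b => if b = true then (-1 : ℤ) else 1) σ c = eps σ c := by
  have h1 : ((-1) ^ (#{x | c x = true}) : ℤ)
      = ∏ q : CQ σ, if c q.out = true then (-1) ^ (cycleLen σ q.out) else 1 := by
    rw [← Finset.prod_const, Finset.prod_filter,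
      ← Finset.prod_fiberwise (s := univ) (g := cls σ)]
    refine Finset.prod_congr rfl fun q _ => ?_
    have : ∀ x ∈ (univ.filter (fun x => cls σ x = q)),
        (if c x = true then (-1 : ℤ) else 1) = if c q.out = true then (-1 : ℤ) else 1 := by
      intro x hx
      rw [← (Finset.mem_filter.1 hx).2, h.out]
    rw [Finset.prod_congr rfl this, Finset.prod_const, cycleLen_eq, cls_out]
    split_ifs <;> simp
  rw [h1]
  unfold wt eps
  rw [← Finset.prod_mul_distrib]
  refine Finset.prod_congr rfl fun q _ => ?_
  cases c q.out <;> simp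

/-- toggling a cycle -/
noncomputable def tog {N : ℕ} (σ : Perm (Fin N)) (x₀ : Fin N) (c : Fin N → Bool) : Fin N → Bool :=
  fun x => if cls σ x = cls σ x₀ then !c x else c x

theorem AA_eq {N : ℕ} (σ : Perm (Fin N)) (k : ℕ) :
    (AA σ k : ℤ) = ∑ c : Fin N → Bool, if Col σ k c then eps σ c else 0 := by
  unfold AA
  rw [← Finset.sum_filter]
  split_ifs with hodd
  · rw [Finset.card_eq_sum_ones, Nat.cast_sum]
    refine Finset.sum_congr rfl fun c hc => ?_
    have hc := (Finset.mem_filter.1 hc).2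
    unfold eps
    rw [Finset.prod_eq_one]
    · simp
    intro q _
    split_ifs with hq
    · have hK : IsKCycleElt σ k q.out := by
        by_contra hK
        rw [((col_iff σ k c).1 hc).2 _ hK] at hq
        simp at hq
      rw [(hodd _ hK).neg_one_pow]; simp
    · rfl
  · push Not at hodd
    obtain ⟨x₀, hK, hev⟩ := hodd
    rw [Nat.not_odd_iff_even] at hev
    symm
    refine Finset.sum_involution (fun c _ => tog σ x₀ c) ?_ ?_ ?_ ?_
    · intro c hc
      have hc := (Finset.mem_filter.1 hc).2
      unfold eps
      rw [← Finset.mul_prod_erase univ _ (mem_univ (cls σ x₀)),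
        ← Finset.mul_prod_erase univ (fun q : CQ σ => if tog σ x₀ c q.out = true then
          -(-1 : ℤ) ^ (cycleLen σ q.out) else 1) (mem_univ (cls σ x₀))]
      have e1 : ∏ q ∈ univ.erase (cls σ x₀), (if tog σ x₀ c q.out = true then
          -(-1 : ℤ) ^ (cycleLen σ q.out) else 1) = ∏ q ∈ univ.erase (cls σ x₀),
          (if c q.out = true then -(-1 : ℤ) ^ (cycleLen σ q.out) else 1) := by
        refine Finset.prod_congr rfl fun q hq => ?_
        have : tog σ x₀ c q.out = c q.out := by
          unfold tog
          rw [cls_out, if_neg (Finset.ne_of_mem_erase hq)]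
        rw [this]
      have e2 : tog σ x₀ c (cls σ x₀).out = !c (cls σ x₀).out := by
        unfold tog
        rw [cls_out, if_pos rfl]
      have e3 : cycleLen σ (cls σ x₀).out = cycleLen σ x₀ := by
        rw [cycleLen_eq, cycleLen_eq, cls_out]
      rw [e1, e2, e3, hev.neg_one_pow]
      cases c (cls σ x₀).out <;> simp
    · intro c _ _ h
      have := congrFun h x₀
      simp [tog] at this
    · intro c hc
      have hc := (Finset.mem_filter.1 hc).2
      rw [Finset.mem_filter]
      refine ⟨mem_univ _, ?_, ?_⟩
      · intro x
        unfold tog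
        rw [inv_cls σ x, hc.1 x]
      · intro x hx
        unfold tog at hx
        split_ifs at hx with h
        · exact hK x (cls_eq.1 h.symm)
        · exact hc.2 x hx
    · intro c _
      ext x
      unfold tog
      split_ifs <;> simp

open Polynomial in
theorem poly_sum (d k : ℕ) : (X : ℤ[X]) * ∑ j ∈ range (d+1), (Nat.card (CSet d k j) : ℤ[X]) * X ^ j
    = ∑ σ : Perm (Fin (d+1)), (AA σ k : ℤ[X]) * X ^ (Fintype.card (CQ σ)) := by
  simp only [card_CSet]
  push_cast
  simp only [Finset.mul_sum, Finset.sum_mul]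
  rw [Finset.sum_comm]
  refine Finset.sum_congr rfl fun σ _ => ?_
  have h1 : 0 < Fintype.card (CQ σ) := Fintype.card_pos_iff.2 ⟨cls σ 0⟩
  have h2 : Fintype.card (CQ σ) ≤ d + 1 := by
    have := Fintype.card_le_of_surjective (cls σ) (fun q => ⟨q.out, cls_out q⟩)
    simpa using this
  rw [Finset.sum_eq_single (Fintype.card (CQ σ) - 1)]
  · rw [numCycles_eq, if_pos (by omega)]
    obtain ⟨m, hm⟩ : ∃ m, Fintype.card (CQ σ) = m + 1 := ⟨_, (Nat.succ_pred_eq_of_pos h1).symm⟩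
    rw [hm]
    simp only [Nat.add_sub_cancel]
    ring
  · intro j _ hj
    rw [numCycles_eq, if_neg (by omega)]
    simp
  · intro h
    exact absurd (Finset.mem_range.2 (by omega)) h

/-- the sign-weight -/
noncomputable def gX : Bool → Polynomial ℤ := fun b => if b = true then -Polynomial.X else Polynomial.X

open Polynomial in
theorem poly_sum2 (N k : ℕ) :
    ∑ σ : Perm (Fin N), (AA σ k : ℤ[X]) * X ^ (Fintype.card (CQ σ))
    = ∑ c : Fin N → Bool, if (∀ x, c x = true → (x : ℕ) < k) then
        (-1) ^ (#{x | c x = true}) * G gX c else 0 := by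
  have h1 : ∀ σ : Perm (Fin N), (AA σ k : ℤ[X]) * X ^ (Fintype.card (CQ σ)) =
      ∑ c : Fin N → Bool, if (∀ x, c x = true → (x : ℕ) < k) then
        (-1) ^ (#{x | c x = true}) * (if PInv σ c then wt gX σ c else 0) else 0 := by
    intro σ
    have : (AA σ k : ℤ[X]) = ((AA σ k : ℤ) : ℤ[X]) := by simp
    rw [this, AA_eq, Int.cast_sum, Finset.sum_mul]
    refine Finset.sum_congr rfl fun c _ => ?_
    by_cases ha : (∀ x, c x = true → (x : ℕ) < k)
    · by_cases hb : PInv σ c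
      · rw [if_pos ha, if_pos hb, if_pos (show Col σ k c from ⟨hb, ha⟩), ← eps_eq σ c hb]
        unfold wt
        push_cast
        rw [mul_assoc]
        congr 1
        rw [← Finset.card_univ, ← Finset.prod_const, ← Finset.prod_mul_distrib]
        refine Finset.prod_congr rfl fun q _ => ?_
        unfold gX
        split_ifs <;> simp
      · rw [if_pos ha, if_neg hb, if_neg (fun h : Col σ k c => hb h.1)]
        simp
    · rw [if_neg ha, if_neg (fun h : Col σ k c => ha h.2)]
      simp
  simp only [h1]
  rw [Finset.sum_comm]
  refine Finset.sum_congr rfl fun c _ => ?_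
  split_ifs
  · unfold G
    rw [Finset.mul_sum]
  · simp

open Polynomial in
theorem poly_sum3 (d k : ℕ) (hk : k ≤ d) :
    (∑ c : Fin (d+1) → Bool, if (∀ x, c x = true → (x : ℕ) < k) then
        (-1) ^ (#{x | c x = true}) * G gX c else 0) =
    X * ∑ i ∈ range (k+1), (k.choose i : ℤ[X]) *
      ((∏ l ∈ range i, ((X : ℤ[X]) - l)) * ∏ l ∈ range (d - i), ((X : ℤ[X]) + l + 1)) := by
  have h1 : ∀ c : Fin (d+1) → Bool, (-1) ^ (#{x | c x = true}) * G gX c =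
      (∏ l ∈ range #{x | c x = true}, ((X : ℤ[X]) - l)) *
        ∏ l ∈ range (d + 1 - #{x | c x = true}), ((X : ℤ[X]) + l) := by
    intro c
    have e : #{x | c x = false} = d + 1 - #{x | c x = true} := by
      have := Finset.card_filter_add_card_filter_not (s := (univ : Finset (Fin (d+1))))
        (fun x => c x = true)
      simp at this
      omega
    rw [G_eq, e, ← mul_assoc]
    congr 1
    rw [← Finset.card_range (#{x | c x = true}), ← Finset.prod_const, Finset.card_range,
      ← Finset.prod_mul_distrib]
    refine Finset.prod_congr rfl fun l _ => ?_
    simp [gX]; ring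
  simp only [h1]
  rw [← Finset.sum_filter]
  set F : ℕ → ℤ[X] := fun i => (∏ l ∈ range i, ((X : ℤ[X]) - l)) *
        ∏ l ∈ range (d + 1 - i), ((X : ℤ[X]) + l) with hF
  have hcard : #{x : Fin (d+1) | (x : ℕ) < k} = k := by
    rw [Fin.card_filter_val_lt]; omega
  have h2 := Finset.sum_powerset_apply_card F (x := ({x | (x : ℕ) < k} : Finset (Fin (d+1))))
  rw [hcard] at h2
  have h3 : ∑ m ∈ ({x | (x : ℕ) < k} : Finset (Fin (d+1))).powerset, F #m =
      ∑ c : Fin (d+1) → Bool with (∀ x : Fin (d+1), c x = true → (x : ℕ) < k), F #{x | c x = true} := by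
    refine Finset.sum_bij' (fun m _ => fun x => decide (x ∈ m))
      (fun c _ => ({x | c x = true} : Finset (Fin (d+1)))) ?_ ?_ ?_ ?_ ?_
    · intro m hm
      rw [Finset.mem_powerset] at hm
      simp only [Finset.mem_filter, mem_univ, true_and, decide_eq_true_eq]
      intro x hx
      simpa using hm hx
    · intro c hc
      rw [Finset.mem_powerset]
      intro x hx
      have := (Finset.mem_filter.1 hc).2 x
      simp at hx ⊢
      exact this hx
    · intro m hm
      ext x; simp
    · intro c hc
      ext x; simp
    · intro m hm
      congr 2
      ext x; simp
  rw [← h3, h2, Finset.mul_sum]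
  refine Finset.sum_congr rfl fun i hi => ?_
  have hi := Finset.mem_range.1 hi
  rw [hF]
  simp only
  rw [show d + 1 - i = (d - i) + 1 by omega, Finset.prod_range_succ', nsmul_eq_mul]
  push_cast
  simp only [add_zero, add_assoc]
  ring

theorem eval_term (n d i : ℕ) (hi : i ≤ d) :
    (∏ l ∈ range i, ((n : ℤ) - l)) * ∏ l ∈ range (d - i), ((n : ℤ) + l + 1) =
      ((d ! * (n + d - i).choose d : ℕ) : ℤ) := by
  obtain ⟨m, rfl⟩ := Nat.exists_eq_add_of_le hi
  have e1 : i + m - i = m := by omega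
  have e2 : n + (i + m) - i = n + m := by omega
  rw [e1, e2, ← Nat.descFactorial_eq_factorial_mul_choose]
  have h1 : (∏ l ∈ range i, ((n : ℤ) - l)) = n.descFactorial i := by
    induction i with
    | zero => simp
    | succ i ih =>
      rw [Finset.prod_range_succ, ih (by omega) (by omega) (by omega), Nat.descFactorial_succ]
      rcases le_or_gt i n with h | h
      · push_cast [h]; ring
      · rw [Nat.descFactorial_eq_zero_iff_lt.2 h]; simp
  have h2 : (∏ l ∈ range m, ((n : ℤ) + l + 1)) = (n + m).descFactorial m := by
    rw [Nat.add_descFactorial_eq_ascFactorial]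
    clear h1 hi e1 e2
    induction m with
    | zero => simp
    | succ m ih => rw [Finset.prod_range_succ, ih, Nat.ascFactorial_succ]; push_cast; ring
  have h3 := Nat.descFactorial_mul_descFactorial (k := m) (m := i + m) (n := n + m) (by omega)
  rw [h1, h2, ← h3]
  simp

open Polynomial in
theorem poly_main (d k : ℕ) (hk : k ≤ d) :
    ∑ j ∈ range (d+1), (Nat.card (CSet d k j) : ℤ[X]) * X ^ j =
    ∑ i ∈ range (k+1), (k.choose i : ℤ[X]) *
      ((∏ l ∈ range i, ((X : ℤ[X]) - l)) * ∏ l ∈ range (d - i), ((X : ℤ[X]) + l + 1)) := by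
  apply mul_left_cancel₀ (X_ne_zero (R := ℤ))
  rw [poly_sum, poly_sum2, poly_sum3 d k hk]

end Helpers

/-- For every `d ≥ 1`, `0 ≤ k ≤ d`, `n ≥ 0`,
`d!·P_{d,k}(n) = ∑_{j=0}^{d} |C_{d,k}(j)| · n^j`. -/
theorem stmt10 (d k n : ℕ) (hd : 1 ≤ d) (hk : k ≤ d) :
    d ! * P d k n = ∑ j ∈ Finset.range (d + 1), Nat.card (CSet d k j) * n ^ j := by
  have h := congrArg (Polynomial.eval (n : ℤ)) (poly_main d k hk)
  simp only [Polynomial.eval_finsetSum, Polynomial.eval_mul, Polynomial.eval_natCast,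
    Polynomial.eval_pow, Polynomial.eval_X, Polynomial.eval_prod, Polynomial.eval_sub,
    Polynomial.eval_add, Polynomial.eval_one] at h
  have h' : ((∑ j ∈ Finset.range (d + 1), Nat.card (CSet d k j) * n ^ j : ℕ) : ℤ)
      = ((d ! * P d k n : ℕ) : ℤ) := by
    push_cast
    rw [h]
    unfold P
    push_cast
    rw [Finset.mul_sum]
    refine Finset.sum_congr rfl fun i hi => ?_
    have hi := Finset.mem_range.1 hi
    rw [eval_term n d i (by omega)]
    push_cast
    ring
  exact_mod_cast h'.symm
end
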